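/- Let $n \ge 2$, $1 \le k \le n-1$, and let $f \in L^1(S^n)$ be an even function on $S^n$. Fix $\tau \in [0,1]$ and suppose that for every nonnegative even integer $j$ the normalized Jacobi polynomial satisfies $R_{j/2}^{(\rho,\sigma)}(2\tau^2-1) \ne 0$, where $\rho = (k-1)/2$, $\sigma = (n-k)/2-1$. If $\int_{S^n} f(x)\,a(|x^Tv|)\,d_*x$ vanishes whenever $a(|x^Tv|) = R_{j/2}^{(\rho,\sigma)}(2|x^Tv|^2-1)$ for all even $j$ and all $v \in V_{n+1,n-k}$, then $f = 0$ almost everywhere on $S^n$. -/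

import Mathlib

open Real MeasureTheory Matrix

/-- The Jacobi polynomial `P_m^{(ρ,σ)}`, given by its explicit hypergeometric series. -/
noncomputable def jacobiP (ρ σ : ℝ) (m : ℕ) (t : ℝ) : ℝ :=
  (Real.Gamma (ρ + m + 1) / (m.factorial * Real.Gamma (ρ + σ + m + 1))) *
    ∑ s ∈ Finset.range (m + 1),
      (m.choose s : ℝ) * Real.Gamma (ρ + σ + m + s + 1) / Real.Gamma (ρ + s + 1) *
        ((t - 1) / 2) ^ s

/-- The normalized Jacobi polynomial `R_m^{(ρ,σ)}(t) = P_m^{(ρ,σ)}(t)/P_m^{(ρ,σ)}(1)`. -/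
noncomputable def jacobiR (ρ σ : ℝ) (m : ℕ) (t : ℝ) : ℝ :=
  jacobiP ρ σ m t / jacobiP ρ σ m 1

/-- The surface area `σ_m = 2π^{(m+1)/2}/Γ((m+1)/2)` of the unit sphere `S^m ⊂ ℝ^{m+1}`. -/
noncomputable def sigmaS (m : ℕ) : ℝ :=
  2 * Real.pi ^ (((m : ℝ) + 1) / 2) / Real.Gamma (((m : ℝ) + 1) / 2)

/-- `|x^T v|`, the length of the orthogonal projection of `x` onto the span of the
columns of `v`. -/
noncomputable def stiefelProj (n k : ℕ) (x : EuclideanSpace ℝ (Fin (n + 1)))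
    (v : Matrix (Fin (n + 1)) (Fin (n - k)) ℝ) : ℝ :=
  Real.sqrt (∑ c : Fin (n - k), (∑ i : Fin (n + 1), x i * v i c) ^ 2)

section Aux

open scoped RealInnerProductSpace

/-- Continuous functions are integrable for a finite measure concentrated on the unit sphere. -/
lemma aux_integrable {E F : Type*} [NormedAddCommGroup E] [InnerProductSpace ℝ E]
    [FiniteDimensional ℝ E] [MeasurableSpace E] [BorelSpace E] [NormedAddCommGroup F]
    [SecondCountableTopology F]
    (μ : Measure E) [IsFiniteMeasure μ] (hμ : μ.restrict (Metric.sphere 0 1) = μ)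
    {h : E → F} (hh : Continuous h) : Integrable h μ := by
  have := FiniteDimensional.proper ℝ E
  rw [← hμ]
  exact hh.continuousOn.integrableOn_compact (isCompact_sphere 0 1)

/-- If a triangular family of polynomials in `g` has the same moments, so do all polynomials. -/
lemma aux_poly {E : Type*} [NormedAddCommGroup E] [InnerProductSpace ℝ E]
    [FiniteDimensional ℝ E] [MeasurableSpace E] [BorelSpace E]
    (μ₁ μ₂ : Measure E) [IsFiniteMeasure μ₁] [IsFiniteMeasure μ₂]
    (h₁ : μ₁.restrict (Metric.sphere 0 1) = μ₁) (h₂ : μ₂.restrict (Metric.sphere 0 1) = μ₂)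
    (g : E → ℝ) (hg : Continuous g) (c : ℕ → ℕ → ℝ) (hc : ∀ m, c m m ≠ 0)
    (hP : ∀ m, ∫ x, ∑ s ∈ Finset.range (m + 1), c m s * g x ^ s ∂μ₁
      = ∫ x, ∑ s ∈ Finset.range (m + 1), c m s * g x ^ s ∂μ₂) (m : ℕ) :
    ∫ x, g x ^ m ∂μ₁ = ∫ x, g x ^ m ∂μ₂ := by
  have key : ∀ (m : ℕ) (μ : Measure E) [IsFiniteMeasure μ],
      μ.restrict (Metric.sphere 0 1) = μ →
      ∫ x, ∑ s ∈ Finset.range (m + 1), c m s * g x ^ s ∂μ =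
        (∑ s ∈ Finset.range m, c m s * ∫ x, g x ^ s ∂μ) + c m m * ∫ x, g x ^ m ∂μ := by
    intro m μ _ hμ
    rw [integral_finsetSum, Finset.sum_range_succ]
    · simp_rw [integral_const_mul]
    · intro i _
      exact aux_integrable μ hμ (by fun_prop)
  induction m using Nat.strong_induction_on with
  | _ m ih =>
    have h := hP m
    rw [key m μ₁ h₁, key m μ₂ h₂, Finset.sum_congr rfl (fun s hs => by
      rw [ih s (Finset.mem_range.1 hs)])] at h
    exact mul_left_cancel₀ (hc m) (add_left_cancel h)

/-- Equality of all linear moments determines the measure. -/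
lemma aux_charFun {E : Type*} [NormedAddCommGroup E] [InnerProductSpace ℝ E]
    [FiniteDimensional ℝ E] [MeasurableSpace E] [BorelSpace E]
    (μ₁ μ₂ : Measure E) [IsFiniteMeasure μ₁] [IsFiniteMeasure μ₂]
    (h₁ : μ₁.restrict (Metric.sphere 0 1) = μ₁) (h₂ : μ₂.restrict (Metric.sphere 0 1) = μ₂)
    (h : ∀ (u : E) (m : ℕ), ∫ x, ⟪x, u⟫ ^ m ∂μ₁ = ∫ x, ⟪x, u⟫ ^ m ∂μ₂) : μ₁ = μ₂ := by
  apply Measure.ext_of_charFun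
  funext u
  rw [charFun_apply, charFun_apply]
  have key : ∀ (μ : Measure E) [IsFiniteMeasure μ], μ.restrict (Metric.sphere 0 1) = μ →
      HasSum (fun m : ℕ => (Complex.I ^ m / (m.factorial : ℂ)) * ((∫ x, ⟪x, u⟫ ^ m ∂μ : ℝ) : ℂ))
        (∫ x, Complex.exp (⟪x, u⟫ * Complex.I) ∂μ) := by
    intro μ _ hμ
    have hae : ∀ᵐ x ∂μ, x ∈ Metric.sphere (0 : E) 1 := by
      rw [← hμ]; exact ae_restrict_mem Metric.isClosed_sphere.measurableSet
    have := hasSum_integral_of_dominated_convergence (μ := μ)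
      (F := fun (m : ℕ) (x : E) => (Complex.I ^ m / (m.factorial : ℂ)) * ((⟪x, u⟫ ^ m : ℝ) : ℂ))
      (f := fun x => Complex.exp (⟪x, u⟫ * Complex.I))
      (fun m _ => ‖u‖ ^ m / m.factorial) ?_ ?_ ?_ ?_ ?_
    · simp_rw [integral_const_mul, integral_complex_ofReal] at this
      exact this
    · intro m
      exact (by fun_prop : Continuous _).aestronglyMeasurable
    · intro m
      filter_upwards [hae] with x hx
      have hx' : ‖x‖ = 1 := by simpa using hx
      have hb : |⟪x, u⟫| ≤ ‖u‖ := by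
        have := abs_real_inner_le_norm x u
        rwa [hx', one_mul] at this
      simp only [norm_mul, norm_div, norm_pow, Complex.norm_I, one_pow, Complex.norm_natCast,
        Complex.norm_real, Real.norm_eq_abs]
      rw [one_div_mul_eq_div]
      gcongr
    · exact Filter.Eventually.of_forall fun _ => Real.summable_pow_div_factorial ‖u‖
    · exact integrable_const _
    · refine Filter.Eventually.of_forall fun x => ?_
      have := NormedSpace.expSeries_div_hasSum_exp (𝔸 := ℂ) ((⟪x, u⟫ : ℂ) * Complex.I)
      rw [← Complex.exp_eq_exp_ℂ] at this
      have hfun : (fun m : ℕ => (Complex.I ^ m / (m.factorial : ℂ)) * ((⟪x, u⟫ ^ m : ℝ) : ℂ)) =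
          fun m : ℕ => ((⟪x, u⟫ : ℂ) * Complex.I) ^ m / (m.factorial : ℂ) := by
        funext m
        push_cast
        ring
      rw [hfun]
      exact this
  have k1 := key μ₁ h₁
  simp_rw [h u] at k1
  exact k1.unique (key μ₂ h₂)

/-- Averaging over the ball of a Euclidean space. -/
lemma aux_ball {N : Type*} [NormedAddCommGroup N] [InnerProductSpace ℝ N]
    [FiniteDimensional ℝ N] [MeasurableSpace N] [BorelSpace N]
    (e y : N) (he : ‖e‖ = 1) (a : ℝ) (m : ℕ) :
    ∫ w in Metric.closedBall (0 : N) 1, (‖w‖ ^ 2 * a + ⟪w, y⟫ ^ 2) ^ m =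
      ∫ w in Metric.closedBall (0 : N) 1, (‖w‖ ^ 2 * a + ‖y‖ ^ 2 * ⟪w, e⟫ ^ 2) ^ m := by
  have hn : ‖(‖y‖ • e)‖ = ‖y‖ := by rw [norm_smul, he, norm_norm, mul_one]
  obtain ⟨φ, hφ⟩ : ∃ φ : N ≃ₗᵢ[ℝ] N, φ (‖y‖ • e) = y :=
    ⟨_, Submodule.reflection_sub hn⟩
  have := (φ.measurePreserving).setIntegral_preimage_emb
    φ.toHomeomorph.measurableEmbedding (fun w => (‖w‖ ^ 2 * a + ⟪w, y⟫ ^ 2) ^ m)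
    (Metric.closedBall (0 : N) 1)
  rw [← this]
  have hpre : φ ⁻¹' Metric.closedBall (0 : N) 1 = Metric.closedBall (0 : N) 1 := by
    ext w; simp
  rw [hpre]
  congr 1
  funext w
  have h1 : ⟪φ w, y⟫ = ‖y‖ * ⟪w, e⟫ := by
    conv_lhs => rw [← hφ]
    rw [φ.inner_map_map, real_inner_smul_right]
  simp only [φ.norm_map, h1]
  ring

lemma aux_pos {N : Type*} [NormedAddCommGroup N] [InnerProductSpace ℝ N]
    [FiniteDimensional ℝ N] [MeasurableSpace N] [BorelSpace N]
    (e e' : N) (he : ‖e‖ = 1) (he' : ‖e'‖ = 1) (hee : ⟪e', e⟫ = 0) (m : ℕ) :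
    0 < ∫ w in Metric.closedBall (0 : N) 1, (‖w‖ ^ 2 - ⟪w, e⟫ ^ 2) ^ m := by
  have hcont : Continuous (fun w : N => (‖w‖ ^ 2 - ⟪w, e⟫ ^ 2) ^ m) := by fun_prop
  have := FiniteDimensional.proper ℝ N
  rw [setIntegral_pos_iff_support_of_nonneg_ae]
  · have hop : IsOpen (Function.support (fun w : N => (‖w‖ ^ 2 - ⟪w, e⟫ ^ 2) ^ m) ∩
        Metric.ball (0 : N) 1) := hcont.isOpen_support.inter Metric.isOpen_ball
    refine lt_of_lt_of_le (hop.measure_pos volume ⟨(1 / 2 : ℝ) • e', ?_, ?_⟩)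
      (measure_mono (Set.inter_subset_inter_right _ Metric.ball_subset_closedBall))
    · simp [norm_smul, he', real_inner_smul_left, hee]
    · simp [norm_smul, he']; norm_num
  · refine Filter.Eventually.of_forall fun w => pow_nonneg ?_ m
    have := abs_real_inner_le_norm w e
    rw [he, mul_one] at this
    have := sq_le_sq' (by linarith [neg_abs_le ⟪w, e⟫, abs_le.1 this |>.1]) (abs_le.1 this).2
    linarith
  · exact hcont.continuousOn.integrableOn_compact (isCompact_closedBall 0 1)

/-- Descent in the dimension of the frames. -/
lemma aux_descent {E : Type*} [NormedAddCommGroup E] [InnerProductSpace ℝ E]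
    [FiniteDimensional ℝ E] [MeasurableSpace E] [BorelSpace E]
    (μ₁ μ₂ : Measure E) [IsFiniteMeasure μ₁] [IsFiniteMeasure μ₂]
    (h₁ : μ₁.restrict (Metric.sphere 0 1) = μ₁) (h₂ : μ₂.restrict (Metric.sphere 0 1) = μ₂)
    (d : ℕ) (hd : d + 2 ≤ Module.finrank ℝ E)
    (h : ∀ v : Fin (d + 1) → E, Orthonormal ℝ v → ∀ m : ℕ,
      ∫ x, (∑ c, ⟪x, v c⟫ ^ 2) ^ m ∂μ₁ = ∫ x, (∑ c, ⟪x, v c⟫ ^ 2) ^ m ∂μ₂)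
    (v : Fin d → E) (hv : Orthonormal ℝ v) (m : ℕ) :
    ∫ x, (∑ c, ⟪x, v c⟫ ^ 2) ^ m ∂μ₁ = ∫ x, (∑ c, ⟪x, v c⟫ ^ 2) ^ m ∂μ₂ := by
  have := FiniteDimensional.proper ℝ E
  set S : Submodule ℝ E := Submodule.span ℝ (Set.range v) with hS
  have hSr : Module.finrank ℝ S = d := by
    have := finrank_span_eq_card hv.linearIndependent
    simpa using this
  have hNr : 2 ≤ Module.finrank ℝ Sᗮ := by
    have := S.finrank_add_finrank_orthogonal
    omega
  -- two orthonormal vectors in the complement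
  let b := stdOrthonormalBasis ℝ Sᗮ
  let e : Sᗮ := b ⟨0, by omega⟩
  let e' : Sᗮ := b ⟨1, by omega⟩
  have he : ‖e‖ = 1 := b.orthonormal.1 _
  have he' : ‖e'‖ = 1 := b.orthonormal.1 _
  have hee : ⟪e', e⟫ = 0 := b.orthonormal.2 (by simp)
  have hvN : ∀ (w : Sᗮ) c, ⟪v c, (w : E)⟫ = 0 := fun w c =>
    S.inner_right_of_mem_orthogonal (Submodule.subset_span ⟨c, rfl⟩) w.2
  -- the hypothesis extended to non-normalized vectors
  have hw : ∀ (w : Sᗮ) (m : ℕ),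
      ∫ x, (‖w‖ ^ 2 * (∑ c, ⟪x, v c⟫ ^ 2) + ⟪x, (w : E)⟫ ^ 2) ^ m ∂μ₁ =
      ∫ x, (‖w‖ ^ 2 * (∑ c, ⟪x, v c⟫ ^ 2) + ⟪x, (w : E)⟫ ^ 2) ^ m ∂μ₂ := by
    intro w m
    obtain ⟨w₁, hw₁, hww⟩ : ∃ w₁ : Sᗮ, ‖w₁‖ = 1 ∧ w = ‖w‖ • w₁ := by
      by_cases h0 : w = 0
      · exact ⟨e, he, by simp [h0]⟩
      · refine ⟨‖w‖⁻¹ • w, ?_, ?_⟩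
        · rw [norm_smul, norm_inv, norm_norm, inv_mul_cancel₀ (norm_ne_zero_iff.2 h0)]
        · rw [smul_smul, mul_inv_cancel₀ (norm_ne_zero_iff.2 h0), one_smul]
    have hort : Orthonormal ℝ (Fin.cons (w₁ : E) v : Fin (d + 1) → E) := by
      constructor
      · intro i
        refine Fin.cases ?_ (fun i => ?_) i
        · simpa using hw₁
        · simpa using hv.1 i
      · intro i
        refine Fin.cases ?_ (fun i => ?_) i
        · intro j
          refine Fin.cases ?_ (fun j => ?_) j
          · intro hij; exact absurd rfl hij
          · intro _
            simp only [Fin.cons_zero, Fin.cons_succ]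
            rw [real_inner_comm]; exact hvN w₁ j
        · intro j
          refine Fin.cases ?_ (fun j => ?_) j
          · intro _
            simp only [Fin.cons_zero, Fin.cons_succ]
            exact hvN w₁ i
          · intro hij
            simp only [Fin.cons_succ]
            exact hv.2 (fun hh => hij (by rw [hh]))
    have hm := h _ hort m
    have heq : ∀ x : E, (‖w‖ ^ 2 * (∑ c, ⟪x, v c⟫ ^ 2) + ⟪x, (w : E)⟫ ^ 2) ^ m =
        (‖w‖ ^ 2) ^ m * (∑ c, ⟪x, (Fin.cons (w₁ : E) v : Fin (d + 1) → E) c⟫ ^ 2) ^ m := by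
      intro x
      have : ⟪x, (w : E)⟫ = ‖w‖ * ⟪x, (w₁ : E)⟫ := by
        conv_lhs => rw [hww]
        rw [Submodule.coe_smul, real_inner_smul_right]
      rw [this, Fin.sum_univ_succ, ← mul_pow]
      simp only [Fin.cons_zero, Fin.cons_succ]
      ring
    simp_rw [heq, integral_const_mul, hm]
  -- Fubini
  let B : Measure Sᗮ := volume.restrict (Metric.closedBall 0 1)
  have fub : ∀ (μ : Measure E) [IsFiniteMeasure μ], μ.restrict (Metric.sphere 0 1) = μ →
      ∀ m : ℕ, ∫ w, ∫ x, (‖w‖ ^ 2 * (∑ c, ⟪x, v c⟫ ^ 2) + ⟪x, (w : E)⟫ ^ 2) ^ m ∂μ ∂B =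
      ∫ x, ∑ s ∈ Finset.range (m + 1), (∫ w, (‖w‖ ^ 2 - ⟪w, e⟫ ^ 2) ^ s *
        (⟪w, e⟫ ^ 2) ^ (m - s) * (m.choose s : ℝ) ∂B) * (∑ c, ⟪x, v c⟫ ^ 2) ^ s ∂μ := by
    intro μ _ hμ m
    have hae : ∀ᵐ x ∂μ, x ∈ Metric.sphere (0 : E) 1 := by
      rw [← hμ]; exact ae_restrict_mem Metric.isClosed_sphere.measurableSet
    rw [← integral_integral_swap (μ := μ) (ν := B)
      (f := fun x w => (‖w‖ ^ 2 * (∑ c, ⟪x, v c⟫ ^ 2) + ⟪x, (w : E)⟫ ^ 2) ^ m)]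
    · apply integral_congr_ae
      filter_upwards [hae] with x hx
      have hx' : ‖x‖ = 1 := by simpa using hx
      set q := ∑ c, ⟪x, v c⟫ ^ 2 with hq
      -- projection onto the complement
      have hymem : x - ∑ c, ⟪x, v c⟫ • v c ∈ Sᗮ := by
        rw [Submodule.mem_orthogonal]
        intro u hu
        induction hu using Submodule.span_induction with
        | mem u hu =>
          obtain ⟨c, rfl⟩ := hu
          rw [inner_sub_right, hv.inner_right_fintype, real_inner_comm, sub_self]
        | zero => simp
        | add u u' _ _ h h' => rw [inner_add_left, h, h', add_zero]
        | smul a u _ h => rw [inner_smul_left, h, mul_zero]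
      let y : Sᗮ := ⟨_, hymem⟩
      have hy : ‖y‖ ^ 2 = 1 - q := by
        have : ⟪x - ∑ c, ⟪x, v c⟫ • v c, x - ∑ c, ⟪x, v c⟫ • v c⟫ = 1 - q := by
          conv_lhs => rw [inner_sub_left, sum_inner]
          have h0 : ∀ c, ⟪⟪x, v c⟫ • v c, x - ∑ c, ⟪x, v c⟫ • v c⟫ = 0 := by
            intro c
            rw [real_inner_smul_left, hvN y c, mul_zero]
          rw [Finset.sum_congr rfl (fun c _ => h0 c), Finset.sum_const_zero, sub_zero,
            inner_sub_right, inner_sum, real_inner_self_eq_norm_sq, hx']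
          simp_rw [real_inner_smul_right, hq, sq]
          norm_num
        rw [← this, real_inner_self_eq_norm_sq]; rfl
      have hyw : ∀ w : Sᗮ, ⟪x, (w : E)⟫ = ⟪w, y⟫ := by
        intro w
        have : ⟪w, y⟫ = ⟪(w : E), x - ∑ c, ⟪x, v c⟫ • v c⟫ := rfl
        rw [this, inner_sub_right, inner_sum]
        have h0 : ∀ c, ⟪(w : E), ⟪x, v c⟫ • v c⟫ = 0 := by
          intro c
          rw [real_inner_smul_right, real_inner_comm (v c) (w : E), hvN w c, mul_zero]
        rw [Finset.sum_congr rfl (fun c _ => h0 c), Finset.sum_const_zero, sub_zero,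
          real_inner_comm]
      simp_rw [hyw]
      rw [aux_ball e y he q m, hy]
      have hex : ∀ w : Sᗮ, (‖w‖ ^ 2 * q + (1 - q) * ⟪w, e⟫ ^ 2) ^ m =
          ∑ s ∈ Finset.range (m + 1), ((‖w‖ ^ 2 - ⟪w, e⟫ ^ 2) ^ s *
            (⟪w, e⟫ ^ 2) ^ (m - s) * (m.choose s : ℝ)) * q ^ s := by
        intro w
        have : ‖w‖ ^ 2 * q + (1 - q) * ⟪w, e⟫ ^ 2 =
          (‖w‖ ^ 2 - ⟪w, e⟫ ^ 2) * q + ⟪w, e⟫ ^ 2 := by ring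
        rw [this, add_pow]
        refine Finset.sum_congr rfl fun s _ => ?_
        rw [mul_pow]; ring
      simp_rw [hex]
      rw [integral_finsetSum]
      · simp_rw [integral_mul_const]; rfl
      · intro s _
        exact (by fun_prop : Continuous _).continuousOn.integrableOn_compact
          (isCompact_closedBall 0 1)
    · rw [← hμ, Measure.prod_restrict]
      refine ContinuousOn.integrableOn_compact
        ((isCompact_sphere 0 1).prod (isCompact_closedBall 0 1)) ?_
      apply Continuous.continuousOn
      unfold Function.uncurry
      fun_prop
  refine aux_poly μ₁ μ₂ h₁ h₂ (fun x => ∑ c, ⟪x, v c⟫ ^ 2) (by fun_prop)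
    (fun m s => ∫ w, (‖w‖ ^ 2 - ⟪w, e⟫ ^ 2) ^ s *
        (⟪w, e⟫ ^ 2) ^ (m - s) * (m.choose s : ℝ) ∂B) ?_ ?_ m
  · intro m
    have := aux_pos e e' he he' hee m
    simp only [Nat.sub_self, pow_zero, mul_one, Nat.choose_self, Nat.cast_one]
    exact this.ne'
  · intro m
    rw [← fub μ₁ h₁ m, ← fub μ₂ h₂ m]
    simp_rw [hw]

end Aux

section Aux2

open scoped RealInnerProductSpace

/-- The Jacobi polynomial coefficients are nonzero and the expansion is in powers of `q - 1`. -/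
lemma aux_jacobi (ρ σ : ℝ) (hρ : 0 ≤ ρ) (hρσ : 0 < ρ + σ + 1) :
    ∃ c : ℕ → ℕ → ℝ, (∀ m, c m m ≠ 0) ∧ ∀ m q, jacobiR ρ σ m (2 * q - 1) =
      ∑ s ∈ Finset.range (m + 1), c m s * (q - 1) ^ s := by
  have g1 : ∀ a : ℝ, 0 < a → Real.Gamma a ≠ 0 := fun a ha => (Real.Gamma_pos_of_pos ha).ne'
  refine ⟨fun m s => (Real.Gamma (ρ + m + 1) / (m.factorial * Real.Gamma (ρ + σ + m + 1))) *
      ((m.choose s : ℝ) * Real.Gamma (ρ + σ + m + s + 1) / Real.Gamma (ρ + s + 1)) /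
      jacobiP ρ σ m 1, ?_, ?_⟩
  · intro m
    have hm : (0 : ℝ) ≤ m := Nat.cast_nonneg m
    have hA := g1 (ρ + m + 1) (by linarith)
    have hB := g1 (ρ + σ + m + 1) (by linarith)
    have hC := g1 (ρ + σ + m + m + 1) (by linarith)
    have hD := g1 (ρ + 1) (by linarith)
    have hF : (m.factorial : ℝ) ≠ 0 := by positivity
    have hP : jacobiP ρ σ m 1 ≠ 0 := by
      unfold jacobiP
      rw [Finset.sum_eq_single 0]
      · simp only [sub_self, zero_div, pow_zero, mul_one, Nat.choose_zero_right, Nat.cast_one,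
          Nat.cast_zero, add_zero, one_mul]
        positivity
      · intro s _ hs
        simp [hs]
      · simp
    simp only [Nat.choose_self, Nat.cast_one, one_mul]
    positivity
  · intro m q
    unfold jacobiR
    conv_lhs => enter [1]; unfold jacobiP
    rw [Finset.mul_sum, Finset.sum_div]
    refine Finset.sum_congr rfl fun s _ => ?_
    have : (2 * q - 1 - 1) / 2 = q - 1 := by ring
    rw [this]
    ring

lemma aux_density {E : Type*} [NormedAddCommGroup E] [InnerProductSpace ℝ E]
    [FiniteDimensional ℝ E] [MeasurableSpace E] [BorelSpace E]
    (ν : Measure E) (hν : ∀ᵐ x ∂ν, x ∈ Metric.sphere (0 : E) 1) (f : E → ℝ)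
    (hf : Integrable f ν) :
    IsFiniteMeasure (ν.withDensity fun x => ENNReal.ofReal (f x)) ∧
    (ν.withDensity fun x => ENNReal.ofReal (f x)).restrict (Metric.sphere 0 1) =
      (ν.withDensity fun x => ENNReal.ofReal (f x)) ∧
    ∀ h : E → ℝ, Continuous h → Integrable (fun x => max (f x) 0 * h x) ν ∧
      ∫ x, h x ∂(ν.withDensity fun x => ENNReal.ofReal (f x)) = ∫ x, max (f x) 0 * h x ∂ν := by
  have i1 : IsFiniteMeasure (ν.withDensity fun x => ENNReal.ofReal (f x)) :=
    isFiniteMeasure_withDensity_ofReal hf.2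
  have i2 : (ν.withDensity fun x => ENNReal.ofReal (f x)).restrict (Metric.sphere 0 1) =
      (ν.withDensity fun x => ENNReal.ofReal (f x)) :=
    Measure.restrict_eq_self_of_ae_mem ((withDensity_absolutelyContinuous _ _).ae_le hν)
  refine ⟨i1, i2, fun h hh => ?_⟩
  have hm : AEMeasurable (fun x => ENNReal.ofReal (f x)) ν := hf.1.aemeasurable.ennreal_ofReal
  have hlt : ∀ᵐ x ∂ν, ENNReal.ofReal (f x) < ⊤ :=
    Filter.Eventually.of_forall fun _ => ENNReal.ofReal_lt_top
  have hi := aux_integrable _ i2 hh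
  constructor
  · rw [integrable_withDensity_iff_integrable_smul₀' hm hlt] at hi
    simpa only [smul_eq_mul, ENNReal.toReal_ofReal'] using hi
  · rw [integral_withDensity_eq_integral_toReal_smul₀ hm hlt]
    simp only [smul_eq_mul, ENNReal.toReal_ofReal']

end Aux2

/-- if an even `f ∈ L¹(S^n)` has all Jacobi-weighted frame moments equal
to zero (for every even degree `j` and every Stiefel frame `v`), and the normalized
Jacobi polynomials do not vanish at `2τ²-1`, then `f = 0` a.e. on `S^n`. -/
theorem injectivity_from_vanishing_moments (n k : ℕ) (hn : 2 ≤ n) (hk : 1 ≤ k)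
    (hkn : k ≤ n - 1)
    (f : EuclideanSpace ℝ (Fin (n + 1)) → ℝ)
    (hf : Integrable f
      ((μH[(n : ℝ)]).restrict (Metric.sphere (0 : EuclideanSpace ℝ (Fin (n + 1))) 1)))
    (heven : ∀ᵐ x ∂((μH[(n : ℝ)]).restrict
        (Metric.sphere (0 : EuclideanSpace ℝ (Fin (n + 1))) 1)), f (-x) = f x)
    (τ : ℝ) (hτ : τ ∈ Set.Icc (0 : ℝ) 1)
    (hnz : ∀ j : ℕ, Even j →
      jacobiR (((k : ℝ) - 1) / 2) (((n : ℝ) - (k : ℝ)) / 2 - 1) (j / 2)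
        (2 * τ ^ 2 - 1) ≠ 0)
    (hvanish : ∀ j : ℕ, Even j → ∀ v : Matrix (Fin (n + 1)) (Fin (n - k)) ℝ, vᵀ * v = 1 →
      (sigmaS n)⁻¹ *
        ∫ x in Metric.sphere (0 : EuclideanSpace ℝ (Fin (n + 1))) 1,
          f x * jacobiR (((k : ℝ) - 1) / 2) (((n : ℝ) - (k : ℝ)) / 2 - 1) (j / 2)
            (2 * stiefelProj n k x v ^ 2 - 1) ∂μH[(n : ℝ)] = 0) :
    ∀ᵐ x ∂((μH[(n : ℝ)]).restrict
        (Metric.sphere (0 : EuclideanSpace ℝ (Fin (n + 1))) 1)), f x = 0 := by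
  have hkn' : 1 ≤ n - k := by omega
  set ν := (μH[(n : ℝ)]).restrict (Metric.sphere (0 : EuclideanSpace ℝ (Fin (n + 1))) 1) with hν
  have hae : ∀ᵐ x ∂ν, x ∈ Metric.sphere (0 : EuclideanSpace ℝ (Fin (n + 1))) 1 :=
    ae_restrict_mem Metric.isClosed_sphere.measurableSet
  obtain ⟨i₁, h₁, k₁⟩ := aux_density ν hae f hf
  obtain ⟨i₂, h₂, k₂⟩ := aux_density ν hae (fun x => -f x) hf.neg
  set μ₁ := ν.withDensity fun x => ENNReal.ofReal (f x) with hμ₁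
  set μ₂ := ν.withDensity fun x => ENNReal.ofReal (-f x) with hμ₂
  -- equality of integrals against continuous functions
  have key : ∀ h : EuclideanSpace ℝ (Fin (n + 1)) → ℝ, Continuous h → ∫ x, f x * h x ∂ν = 0 →
      ∫ x, h x ∂μ₁ = ∫ x, h x ∂μ₂ := by
    intro h hh h0
    rw [(k₁ h hh).2, (k₂ h hh).2, ← sub_eq_zero, ← integral_sub (k₁ h hh).1 (k₂ h hh).1]
    refine Eq.trans ?_ h0
    congr 1
    funext x
    rw [← sub_mul]
    congr 1
    rcases le_total (f x) 0 with hx | hx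
    · rw [max_eq_right hx, max_eq_left (by linarith)]; ring
    · rw [max_eq_left hx, max_eq_right (by linarith)]; ring
  have hsig : (sigmaS n)⁻¹ ≠ 0 := by
    unfold sigmaS
    have := Real.Gamma_pos_of_pos (s := ((n : ℝ) + 1) / 2) (by positivity)
    have := Real.pi_pos
    positivity
  have hknR : (k : ℝ) + 1 ≤ n := by
    have : k + 1 ≤ n := by omega
    exact_mod_cast this
  have hkR : (1 : ℝ) ≤ k := by exact_mod_cast hk
  obtain ⟨c, hc, hcR⟩ := aux_jacobi (((k : ℝ) - 1) / 2) (((n : ℝ) - (k : ℝ)) / 2 - 1)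
    (by linarith) (by linarith)
  -- moments for frames of size `n - k`
  have hbase : ∀ v : Fin (n - k) → EuclideanSpace ℝ (Fin (n + 1)), Orthonormal ℝ v → ∀ m : ℕ,
      ∫ x, (∑ c, inner ℝ x (v c) ^ 2) ^ m ∂μ₁ = ∫ x, (∑ c, inner ℝ x (v c) ^ 2) ^ m ∂μ₂ := by
    intro v hv
    have hsp : ∀ x, stiefelProj n k x (Matrix.of fun i c => v c i) ^ 2 =
        ∑ c, inner ℝ x (v c) ^ 2 := by
      intro x
      unfold stiefelProj
      rw [Real.sq_sqrt (Finset.sum_nonneg fun _ _ => sq_nonneg _)]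
      refine Finset.sum_congr rfl fun c _ => ?_
      congr 1
      rw [PiLp.inner_apply]
      refine Finset.sum_congr rfl fun i _ => ?_
      simp [mul_comm]
    have hfr : (Matrix.of fun i c => v c i)ᵀ * (Matrix.of fun i c => v c i) = 1 := by
      ext a b
      have := orthonormal_iff_ite.1 hv a b
      rw [PiLp.inner_apply] at this
      rw [Matrix.mul_apply, Matrix.one_apply, ← this]
      refine Finset.sum_congr rfl fun i _ => ?_
      simp [mul_comm]
    have hstep := aux_poly μ₁ μ₂ h₁ h₂ (fun x => (∑ c, inner ℝ x (v c) ^ 2) - 1)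
      (by fun_prop) c hc (by
        intro m
        refine key _ (by fun_prop) ?_
        have := hvanish (2 * m) (even_two_mul m) _ hfr
        have := (mul_eq_zero.1 this).resolve_left hsig
        simp_rw [Nat.mul_div_cancel_left m (two_pos), hsp, hcR] at this
        exact this)
    refine aux_poly μ₁ μ₂ h₁ h₂ (fun x => ∑ c, inner ℝ x (v c) ^ 2)
      (by fun_prop) (fun m s => (-1) ^ (m - s) * m.choose s) (by simp) ?_
    intro m
    have hex : ∀ x : EuclideanSpace ℝ (Fin (n + 1)),
        ∑ s ∈ Finset.range (m + 1), ((-1 : ℝ) ^ (m - s) * m.choose s) *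
          (∑ c, inner ℝ x (v c) ^ 2) ^ s = ((∑ c, inner ℝ x (v c) ^ 2) - 1) ^ m := by
      intro x
      rw [sub_eq_add_neg, add_pow]
      refine Finset.sum_congr rfl fun s _ => ?_
      ring
    simp_rw [hex]
    exact hstep m
  -- descent to single vectors
  have hone : ∀ v : Fin 1 → EuclideanSpace ℝ (Fin (n + 1)), Orthonormal ℝ v → ∀ m : ℕ,
      ∫ x, (∑ c, inner ℝ x (v c) ^ 2) ^ m ∂μ₁ = ∫ x, (∑ c, inner ℝ x (v c) ^ 2) ^ m ∂μ₂ := by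
    have hdesc : ∀ j d : ℕ, d + j = n - k → 1 ≤ d →
        ∀ v : Fin d → EuclideanSpace ℝ (Fin (n + 1)), Orthonormal ℝ v → ∀ m : ℕ,
        ∫ x, (∑ c, inner ℝ x (v c) ^ 2) ^ m ∂μ₁ =
          ∫ x, (∑ c, inner ℝ x (v c) ^ 2) ^ m ∂μ₂ := by
      intro j
      induction j with
      | zero =>
        intro d hd _
        have hd' : d = n - k := by omega
        subst hd'
        exact hbase
      | succ j ih =>
        intro d hd hd1
        refine aux_descent μ₁ μ₂ h₁ h₂ d ?_ (ih (d + 1) (by omega) (by omega))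
        rw [finrank_euclideanSpace_fin]
        omega
    exact hdesc (n - k - 1) 1 (by omega) le_rfl
  have hEq : μ₁ = μ₂ := by
    refine aux_charFun μ₁ μ₂ h₁ h₂ fun u m => ?_
    rcases Nat.even_or_odd m with hm | hm
    · obtain ⟨p, rfl⟩ := hm
      obtain ⟨u₁, hu₁, huu⟩ : ∃ u₁ : EuclideanSpace ℝ (Fin (n + 1)), ‖u₁‖ = 1 ∧ u = ‖u‖ • u₁ := by
        by_cases h0 : u = 0
        · obtain ⟨e, he⟩ := exists_norm_eq (EuclideanSpace ℝ (Fin (n + 1))) zero_le_one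
          exact ⟨e, he, by simp [h0]⟩
        · refine ⟨‖u‖⁻¹ • u, ?_, ?_⟩
          · rw [norm_smul, norm_inv, norm_norm, inv_mul_cancel₀ (norm_ne_zero_iff.2 h0)]
          · rw [smul_smul, mul_inv_cancel₀ (norm_ne_zero_iff.2 h0), one_smul]
      have h1 := hone (fun _ => u₁) ⟨fun _ => hu₁, fun i j hij => absurd (Subsingleton.elim i j) hij⟩ p
      have hex : ∀ x : EuclideanSpace ℝ (Fin (n + 1)), inner ℝ x u ^ (p + p) =
          ‖u‖ ^ (p + p) * (∑ _c : Fin 1, inner ℝ x u₁ ^ 2) ^ p := by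
        intro x
        have : inner ℝ x u = ‖u‖ * inner ℝ x u₁ := by
          conv_lhs => rw [huu]
          rw [real_inner_smul_right]
        rw [this, mul_pow, Fin.sum_univ_one, ← pow_mul, two_mul]
      simp_rw [hex, integral_const_mul, h1]
    · refine key _ (by fun_prop) ?_
      have hmp : MeasurePreserving (Neg.neg : EuclideanSpace ℝ (Fin (n + 1)) → _) ν ν := by
        have h := (IsometryEquiv.neg (EuclideanSpace ℝ (Fin (n + 1)))).measurePreserving_hausdorffMeasure
          (n : ℝ)
        have h' := h.restrict_preimage
          (Metric.isClosed_sphere (x := (0 : EuclideanSpace ℝ (Fin (n + 1)))) (ε := 1)).measurableSet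
        have hpre : (IsometryEquiv.neg (EuclideanSpace ℝ (Fin (n + 1)))) ⁻¹'
            Metric.sphere (0 : EuclideanSpace ℝ (Fin (n + 1))) 1 = Metric.sphere 0 1 := by
          ext x; simp
        rw [hpre] at h'
        exact h'
      have e1 := hmp.integral_comp (Homeomorph.neg (EuclideanSpace ℝ (Fin (n + 1)))).measurableEmbedding
        (fun x => f x * inner ℝ x u ^ m)
      have e2 : ∫ x, f (-x) * inner ℝ (-x) u ^ m ∂ν = ∫ x, -(f x * inner ℝ x u ^ m) ∂ν := by
        apply integral_congr_ae
        filter_upwards [heven] with x hx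
        rw [hx, inner_neg_left, hm.neg_pow]
        ring
      rw [integral_neg] at e2
      have e1' : ∫ x, f (-x) * inner ℝ (-x) u ^ m ∂ν = ∫ x, f x * inner ℝ x u ^ m ∂ν := e1
      linarith
  have hfin : ∫⁻ x, ENNReal.ofReal (f x) ∂ν ≠ ⊤ := by
    have := hf.lintegral_lt_top
    exact this.ne
  have := (withDensity_eq_iff hf.1.aemeasurable.ennreal_ofReal
    hf.neg.1.aemeasurable.ennreal_ofReal hfin).1 hEq
  filter_upwards [this] with x hx
  simp only [Pi.neg_apply] at hx
  rcases le_total (f x) 0 with h0 | h0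
  · rw [ENNReal.ofReal_of_nonpos h0, eq_comm, ENNReal.ofReal_eq_zero] at hx
    linarith
  · rw [ENNReal.ofReal_of_nonpos (p := -f x) (by linarith), ENNReal.ofReal_eq_zero] at hx
    linarith
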